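/- For every a ∈ (0, π/2), the Holmes-Thompson volume of the Finsler Mobius band M_{F_a} equals 2π; equivalently, (2/π)·∫_{−π/2}^{π/2} ∫_{−a}^{a} ( arccos(cos(a)/cos(v)) + cos(a)/√(cos²(v) − cos²(a)) )·cos(v) du dv = 2π. -/

import Mathlib

open Set MeasureTheory Real

noncomputable section

/-! ### A concrete framework for Finsler surfaces

All the surfaces considered in this paper (Möbius bands, cylinders, tori, Klein bottles)
are quotients of (a strip in) the plane `ℝ²` by a group `G` of deck transformations.
We formalize the geometry upstairs: a Finsler metric is a function on `ℝ² × ℝ²`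
(point, tangent vector), invariant under the deck transformations; loops (resp. arcs) of
the quotient surface are described by their lifts, and (relative) null-homotopy is
expressed, via the homotopy lifting property of coverings, by equivariant homotopies of
the lifts. -/

/-- Points of the plane `ℝ²`, the (universal) cover of our surfaces. -/
abbrev Pt : Type := ℝ × ℝ

/-- A (reversible) Finsler metric on (a region of) the plane: continuous, smooth outside
the zero section, absolutely homogeneous in the tangent variable, and quadratically convex
(the second derivative of `F_x²` on each tangent plane is positive definite). -/
structure IsFinslerMetric (F : Pt → Pt → ℝ) : Prop where
  nonneg : ∀ x v : Pt, 0 ≤ F x v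
  cont : Continuous fun q : Pt × Pt => F q.1 q.2
  smooth : ContDiffOn ℝ (⊤ : ℕ∞) (fun q : Pt × Pt => F q.1 q.2) {q : Pt × Pt | q.2 ≠ 0}
  homog : ∀ (x v : Pt) (t : ℝ), F x (t • v) = |t| * F x v
  quadconvex : ∀ x v : Pt, v ≠ 0 → ∀ u : Pt, u ≠ 0 →
    0 < iteratedFDeriv ℝ 2 (fun y : Pt => F x y ^ 2) v ![u, u]

/-- A piecewise smooth curve parametrized by `[0,1]`. -/
def PiecewiseSmooth (γ : ℝ → Pt) : Prop :=
  ContinuousOn γ (Icc 0 1) ∧ ∃ s : Finset ℝ, ∀ t ∈ Icc (0:ℝ) 1, t ∉ s → ContDiffAt ℝ (⊤ : ℕ∞) γ t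

/-- The Finsler length `∫ F(γ(t), γ'(t)) dt` of a curve parametrized by `[0,1]`. -/
def flen (F : Pt → Pt → ℝ) (γ : ℝ → Pt) : ℝ := ∫ t in (0:ℝ)..1, F (γ t) (deriv γ t)

/-- The unit square (homotopy parameter × curve parameter). -/
def uSq : Set (ℝ × ℝ) := Icc (0:ℝ) 1 ×ˢ Icc (0:ℝ) 1

/-- `γ` is a curve in `A ⊆ ℝ²` closing up, via the deck transformation `d`, to a loop of
the quotient surface (`γ 1 = d (γ 0)`).  By the homotopy lifting property, the projected
loop is nullhomotopic in the quotient of `A` iff there is a homotopy of `γ`, through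
curves in `A` closing up via `d`, ending at a constant curve. -/
def NullHomotopic (A : Set Pt) (d : Pt → Pt) (γ : ℝ → Pt) : Prop :=
  ∃ H : ℝ × ℝ → Pt, ContinuousOn H uSq ∧ (∀ q ∈ uSq, H q ∈ A) ∧
    (∀ t ∈ Icc (0:ℝ) 1, H (0, t) = γ t) ∧
    (∀ s ∈ Icc (0:ℝ) 1, H (s, 1) = d (H (s, 0))) ∧
    ∃ c : Pt, ∀ t ∈ Icc (0:ℝ) 1, H (1, t) = c

/-- The set of lengths of noncontractible piecewise smooth loops of the quotient of `A`
by the deck transformation group `G`, described by their lifts to `A`. -/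
def sysSet (A : Set Pt) (G : Set (Pt → Pt)) (F : Pt → Pt → ℝ) : Set ℝ :=
  {l | ∃ γ : ℝ → Pt, ∃ d ∈ G, PiecewiseSmooth γ ∧ (∀ t ∈ Icc (0:ℝ) 1, γ t ∈ A) ∧
    γ 1 = d (γ 0) ∧ ¬ NullHomotopic A d γ ∧ l = flen F γ}

/-- The systole of `A/G`: the least length of a noncontractible loop. -/
def sysOf (A : Set Pt) (G : Set (Pt → Pt)) (F : Pt → Pt → ℝ) : ℝ := sInf (sysSet A G F)

/-- An arc of the surface covered by `A`, with endpoints on the preimage `B` of the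
boundary, induces a trivial class in the relative `π₁` iff (by homotopy lifting) its lift
can be homotoped into `B` inside `A`, keeping its endpoints on `B`. -/
def RelNullHomotopic (A B : Set Pt) (γ : ℝ → Pt) : Prop :=
  ∃ H : ℝ × ℝ → Pt, ContinuousOn H uSq ∧ (∀ q ∈ uSq, H q ∈ A) ∧
    (∀ t ∈ Icc (0:ℝ) 1, H (0, t) = γ t) ∧
    (∀ s ∈ Icc (0:ℝ) 1, H (s, 0) ∈ B ∧ H (s, 1) ∈ B) ∧
    (∀ t ∈ Icc (0:ℝ) 1, H (1, t) ∈ B)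

/-- Lengths of piecewise smooth arcs with endpoints on the boundary (covered by `B`)
inducing a nontrivial class in the relative `π₁`. -/
def heightSet (A B : Set Pt) (F : Pt → Pt → ℝ) : Set ℝ :=
  {l | ∃ γ : ℝ → Pt, PiecewiseSmooth γ ∧ (∀ t ∈ Icc (0:ℝ) 1, γ t ∈ A) ∧
    γ 0 ∈ B ∧ γ 1 ∈ B ∧ ¬ RelNullHomotopic A B γ ∧ l = flen F γ}

/-- The height of the surface covered by `A`, with boundary covered by `B`. -/
def heightOf (A B : Set Pt) (F : Pt → Pt → ℝ) : ℝ := sInf (heightSet A B F)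

/-- The Euclidean area of the dual unit ball `B*_x` of `F` at the point `x`, with respect
to the standard pairing. -/
def dualArea (F : Pt → Pt → ℝ) (x : Pt) : ℝ :=
  (volume {y : Pt | ∀ v : Pt, F x v ≤ 1 → y.1 * v.1 + y.2 * v.2 ≤ 1}).toReal

/-! ### The Möbius band

The Möbius band of "period" `L > 0` and half-width `w > 0` is the quotient of the strip
`{(x,y) : |y| ≤ w}` by the glide reflection `(x,y) ↦ (x+L, −y)`; every Finsler Möbius
band is isometric to such a quotient, for a deck-invariant Finsler metric `F`. -/

/-- The deck transformations of the Möbius band: iterates of the glide reflection. -/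
def mdeck (L : ℝ) (k : ℤ) (p : Pt) : Pt := (p.1 + (k : ℝ) * L, (-1 : ℝ) ^ k * p.2)

def mobiusGroup (L : ℝ) : Set (Pt → Pt) := {d | ∃ k : ℤ, d = mdeck L k}

/-- Deck transformations corresponding to orientation-reversing (nonorientable) loops. -/
def mobiusGroupOdd (L : ℝ) : Set (Pt → Pt) := {d | ∃ k : ℤ, Odd k ∧ d = mdeck L k}

/-- Deck transformations corresponding to orientation-preserving (orientable) loops. -/
def mobiusGroupEven (L : ℝ) : Set (Pt → Pt) := {d | ∃ k : ℤ, Even k ∧ d = mdeck L k}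

/-- The strip of half-width `w`, universal cover of the Möbius band. -/
def mstrip (w : ℝ) : Set Pt := {p : Pt | |p.2| ≤ w}

/-- The two boundary lines of the strip, covering the boundary circle of the Möbius band. -/
def mbdry (w : ℝ) : Set Pt := {p : Pt | |p.2| = w}

/-- Invariance of the metric under the glide reflection (whose differential acts by
`(ξ,η) ↦ (ξ,−η)`), so that `F` descends to the Möbius band. -/
def MobiusInvariant (L : ℝ) (F : Pt → Pt → ℝ) : Prop :=
  ∀ p v : Pt, F (p.1 + L, -p.2) (v.1, -v.2) = F p v

/-- The systole of the Finsler Möbius band. -/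
def mobiusSys (L w : ℝ) (F : Pt → Pt → ℝ) : ℝ := sysOf (mstrip w) (mobiusGroup L) F

/-- The nonorientable systole `sys₋`. -/
def mobiusSysMinus (L w : ℝ) (F : Pt → Pt → ℝ) : ℝ := sysOf (mstrip w) (mobiusGroupOdd L) F

/-- The orientable systole `sys₊`. -/
def mobiusSysPlus (L w : ℝ) (F : Pt → Pt → ℝ) : ℝ := sysOf (mstrip w) (mobiusGroupEven L) F

/-- The height of the Finsler Möbius band. -/
def mobiusHeight (L w : ℝ) (F : Pt → Pt → ℝ) : ℝ := heightOf (mstrip w) (mbdry w) F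

/-- The Holmes–Thompson volume of the Finsler Möbius band, computed over a fundamental
domain (`ε₂ = π`). -/
def mobiusVolHT (L w : ℝ) (F : Pt → Pt → ℝ) : ℝ :=
  (1 / π) * ∫ x in Icc (0:ℝ) L ×ˢ Icc (-w) w, dualArea F x

/-- The Finsler distance from a point of the Möbius band to its boundary. -/
def distToBdry (w : ℝ) (F : Pt → Pt → ℝ) (p : Pt) : ℝ :=
  sInf {l | ∃ γ : ℝ → Pt, PiecewiseSmooth γ ∧ (∀ t ∈ Icc (0:ℝ) 1, γ t ∈ mstrip w) ∧
    γ 0 = p ∧ γ 1 ∈ mbdry w ∧ l = flen F γ}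

/-! ### The Klein bottle

The Klein bottle is the quotient `ℝ²/G` where `G` is generated by the glide reflection
`(x,y) ↦ (x+π, −y)` and the vertical translation `(x,y) ↦ (x, y+2b)`, `b > 0`. -/

/-- The deck transformations of the Klein bottle. -/
def kdeck (b : ℝ) (m n : ℤ) (p : Pt) : Pt :=
  (p.1 + (m : ℝ) * π, (-1 : ℝ) ^ m * p.2 + 2 * (n : ℝ) * b)

def kleinGroup (b : ℝ) : Set (Pt → Pt) := {d | ∃ m n : ℤ, d = kdeck b m n}

/-- Invariance of the metric under the deck group of the Klein bottle. -/
def KleinInvariant (b : ℝ) (F : Pt → Pt → ℝ) : Prop :=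
  (∀ p v : Pt, F (p.1 + π, -p.2) (v.1, -v.2) = F p v) ∧
  (∀ p v : Pt, F (p.1, p.2 + 2 * b) v = F p v)

/-- The systole of the Finsler Klein bottle. -/
def kleinSys (b : ℝ) (F : Pt → Pt → ℝ) : ℝ := sysOf univ (kleinGroup b) F

/-- The Holmes–Thompson volume of the Finsler Klein bottle, over a fundamental domain. -/
def kleinVolHT (b : ℝ) (F : Pt → Pt → ℝ) : ℝ :=
  (1 / π) * ∫ x in Icc (0:ℝ) π ×ˢ Icc (0:ℝ) (2 * b), dualArea F x

/-- The metric has a soul symmetry: its lift is invariant under `(x,y) ↦ (x,−y)`. -/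
def SoulSymmetric (F : Pt → Pt → ℝ) : Prop :=
  ∀ p v : Pt, F (p.1, -p.2) (v.1, -v.2) = F p v

/-- The metric has a soul-switching symmetry: its lift is invariant under
`(x,y) ↦ (x, b−y)`. -/
def SoulSwitchingSymmetric (b : ℝ) (F : Pt → Pt → ℝ) : Prop :=
  ∀ p v : Pt, F (p.1, b - p.2) (v.1, -v.2) = F p v

/-- The metric has a rotational symmetry: its lift is invariant under `(x,y) ↦ (x+θ, y)`
for every `θ ∈ [0,2π]`. -/
def RotationSymmetric (F : Pt → Pt → ℝ) : Prop :=
  ∀ θ ∈ Icc (0:ℝ) (2 * π), ∀ p v : Pt, F (p.1 + θ, p.2) v = F p v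

/-- The Möbius band obtained by cutting the Klein bottle open along the soul `{y = b}`:
it is the quotient of the strip `{|y| ≤ b}` by the glide reflection `(x,y) ↦ (x+π,−y)`,
and its height is: -/
def kleinMobiusHeight (b : ℝ) (F : Pt → Pt → ℝ) : ℝ := mobiusHeight π b F

/-- The half-angle `θ(v) = arccos(cos a / cos v)` of the cone of directions of great
circles of `S_a` at a point of latitude `v`. -/
def thetaFn (a v : ℝ) : ℝ := Real.arccos (Real.cos a / Real.cos v)

/-- The Finsler metric `F_a` on the spherical band `S_a`, in longitude-latitude
coordinates `(u,v)`: its unit ball at a point of latitude `v` is the convex hull of the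
directions of great circles, namely (in the orthonormal frame `((1/cos v)∂_u, ∂_v)` of the
round metric) the set `{(η₁,η₂) : η₁² + η₂² ≤ 1, |η₂| ≤ sin θ(v)}`.  Its gauge is the
maximum of the round norm and of `|η₂|/sin θ(v)`; it descends through the antipodal map
`(u,v) ↦ (u+π, −v)` to the Möbius band `M_{F_a}`, modelled here as the Möbius band of
period `π` and half-width `a`. -/
def Fa (a : ℝ) (p v : Pt) : ℝ :=
  max (Real.sqrt ((v.1 * Real.cos p.2) ^ 2 + v.2 ^ 2))
    (|v.2| / Real.sin (thetaFn a p.2))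

/-- The half-height of the dual unit ball above the first coordinate `p`. -/
def hFn (k s p : ℝ) : ℝ := if |p| ≤ k then (1 - |p| * k) / s else Real.sqrt (1 - p ^ 2)

lemma hFn_cont {k s : ℝ} (hk : 0 < k) (hs : 0 < s) (h1 : s ^ 2 + k ^ 2 = 1) :
    Continuous (hFn k s) := by
  unfold hFn
  refine Continuous.if_le ?_ ?_ continuous_abs continuous_const ?_
  · fun_prop
  · fun_prop
  · intro p hp
    have e : 1 - p ^ 2 = s ^ 2 := by rw [← sq_abs, hp]; linarith
    rw [e, Real.sqrt_sq hs.le, hp]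
    field_simp
    nlinarith

lemma hFn_nonneg {k s : ℝ} (hk : 0 < k) (hs : 0 < s) (h1 : s ^ 2 + k ^ 2 = 1) (p : ℝ) :
    0 ≤ hFn k s p := by
  unfold hFn
  split_ifs with h
  · apply div_nonneg _ hs.le
    have : |p| * k ≤ k * k := by gcongr
    nlinarith
  · exact Real.sqrt_nonneg _

lemma hFn_even (k s p : ℝ) : hFn k s (-p) = hFn k s p := by
  simp [hFn]

lemma dual_iff {k s p : ℝ} (hk : 0 < k) (hs : 0 < s) (h1 : s ^ 2 + k ^ 2 = 1) (hp : |p| < 1)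
    (q : ℝ) :
    (∀ x y : ℝ, x ^ 2 + y ^ 2 ≤ 1 → |y| ≤ s → p * x + q * y ≤ 1) ↔ |q| ≤ hFn k s p := by
  have hp2 : p ^ 2 < 1 := by
    rw [← sq_abs]; have := abs_nonneg p; nlinarith
  constructor
  · intro H
    have key : ∀ x y : ℝ, 0 ≤ x → 0 ≤ y → x ^ 2 + y ^ 2 ≤ 1 → y ≤ s →
        |p| * x + |q| * y ≤ 1 := by
      intro x y hx hy hxy hys
      rcases abs_cases p with ⟨e1, _⟩ | ⟨e1, _⟩ <;> rcases abs_cases q with ⟨e2, _⟩ | ⟨e2, _⟩ <;>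
        rw [e1, e2]
      · exact H x y hxy (by rwa [abs_of_nonneg hy])
      · have := H x (-y) (by linarith [neg_sq y]) (by rwa [abs_neg, abs_of_nonneg hy])
        linarith
      · have := H (-x) y (by linarith [neg_sq x]) (by rwa [abs_of_nonneg hy])
        linarith
      · have := H (-x) (-y) (by linarith [neg_sq x, neg_sq y])
          (by rwa [abs_neg, abs_of_nonneg hy])
        linarith
    unfold hFn
    split_ifs with h
    · rw [le_div_iff₀ hs]
      have := key k s hk.le hs.le (by linarith) le_rfl
      linarith
    · push Not at h
      have hr : 0 < Real.sqrt (1 - p ^ 2) := Real.sqrt_pos.mpr (by linarith)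
      have hr2 : Real.sqrt (1 - p ^ 2) ^ 2 = 1 - p ^ 2 := Real.sq_sqrt (by linarith)
      have hrs : Real.sqrt (1 - p ^ 2) ≤ s := by
        rw [Real.sqrt_le_left hs.le]
        rw [← sq_abs p]; nlinarith
      have := key |p| (Real.sqrt (1 - p ^ 2)) (abs_nonneg p) hr.le
        (by rw [hr2, sq_abs]; linarith) hrs
      have e : |p| * |p| = p ^ 2 := by rw [← sq, sq_abs]
      by_contra hc
      push Not at hc
      nlinarith
  · intro H x y hxy hy
    have b1 : p * x + q * y ≤ |p| * |x| + |q| * |y| := by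
      rw [← abs_mul, ← abs_mul]; exact add_le_add (le_abs_self _) (le_abs_self _)
    refine b1.trans ?_
    have hxy' : |x| ^ 2 + |y| ^ 2 ≤ 1 := by simpa only [sq_abs] using hxy
    have hx0 := abs_nonneg x
    have hy0 := abs_nonneg y
    have hp0 := abs_nonneg p
    have hq0 := abs_nonneg q
    generalize |x| = X at *
    generalize |y| = Y at *
    unfold hFn at H
    split_ifs at H with h
    · obtain ⟨t, rfl⟩ : ∃ t, Y = s * t := ⟨Y / s, by field_simp⟩
      have ht1 : t ≤ 1 := by by_contra hc; push Not at hc; nlinarith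
      have ht0 : 0 ≤ t := by by_contra hc; push Not at hc; nlinarith
      rw [le_div_iff₀ hs] at H
      have a1 : |q| * (s * t) ≤ (1 - |p| * k) * t := by
        rw [← mul_assoc]; gcongr
      rcases le_total X (k * t) with h2 | h2
      · nlinarith [mul_le_mul_of_nonneg_left h2 hp0]
      · have a2 : |p| * (X - k * t) ≤ k * (X - k * t) := by
          apply mul_le_mul_of_nonneg_right h; linarith
        have a3 : k * X + s * (s * t) ≤ 1 := by
          nlinarith [sq_nonneg (k - X), sq_nonneg (s - s * t)]
        have e : s * (s * t) = t - k * (k * t) := by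
          have : s * s = 1 - k * k := by linarith
          rw [← mul_assoc, this]; ring
        nlinarith
    · have hr2 : Real.sqrt (1 - p ^ 2) ^ 2 = 1 - p ^ 2 := Real.sq_sqrt (by linarith)
      have e := sq_abs p
      have a1 := mul_le_mul_of_nonneg_right H hy0
      nlinarith [sq_nonneg (|p| - X), sq_nonneg (Real.sqrt (1 - p ^ 2) - Y)]

lemma integral_hFn {t : ℝ} (ht : t ∈ Ioo 0 (π / 2)) :
    ∫ p in (-1 : ℝ)..1, hFn (Real.cos t) (Real.sin t) p
      = t + Real.cos t / Real.sin t := by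
  have hk : 0 < Real.cos t := Real.cos_pos_of_mem_Ioo ⟨by linarith [ht.1, Real.pi_pos], ht.2⟩
  have hs : 0 < Real.sin t := Real.sin_pos_of_pos_of_lt_pi ht.1 (by linarith [ht.2, Real.pi_pos])
  have h1 := Real.sin_sq_add_cos_sq t
  have hac : Real.arcsin (Real.cos t) = π / 2 - t := by
    rw [← Real.sin_pi_div_two_sub, Real.arcsin_sin] <;> linarith [ht.1, ht.2]
  have hk1 : Real.cos t ≤ 1 := Real.cos_le_one t
  have hsq : Real.sqrt (1 - Real.cos t ^ 2) = Real.sin t := by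
    rw [← h1, add_sub_cancel_right, Real.sqrt_sq hs.le]
  set k := Real.cos t
  set s := Real.sin t
  have hc := hFn_cont hk hs h1
  have hI : ∀ a b : ℝ, IntervalIntegrable (hFn k s) volume a b := fun a b =>
    hc.intervalIntegrable a b
  have e1 : ∫ p in (-1 : ℝ)..0, hFn k s p = ∫ p in (0 : ℝ)..1, hFn k s p := by
    have := intervalIntegral.integral_comp_neg (a := 0) (b := 1) (hFn k s)
    simp only [hFn_even, neg_zero] at this
    exact this.symm
  have e2 : ∫ p in (0 : ℝ)..k, hFn k s p = (k - k ^ 3 / 2) / s := by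
    have : ∫ p in (0 : ℝ)..k, hFn k s p = ∫ p in (0 : ℝ)..k, (1 - p * k) / s := by
      apply intervalIntegral.integral_congr
      intro p hp
      rw [uIcc_of_le hk.le] at hp
      simp only [hFn, abs_of_nonneg hp.1, if_pos hp.2]
    rw [this, intervalIntegral.integral_div, intervalIntegral.integral_sub, 
      intervalIntegral.integral_mul_const, integral_id]
    · simp; ring
    · simp
    · exact Continuous.intervalIntegrable (by fun_prop) _ _
  have e3 : ∫ p in k..1, hFn k s p = t / 2 - k * s / 2 := by
    have hd : ∀ x ∈ Ioo k 1, HasDerivAt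
        (fun x => (Real.arcsin x + x * Real.sqrt (1 - x ^ 2)) / 2) (hFn k s x) x := by
      intro x hx
      have hx0 : 0 < x := hk.trans hx.1
      have hpos : 0 < 1 - x ^ 2 := by nlinarith [hx.2]
      have hh : hFn k s x = Real.sqrt (1 - x ^ 2) := by
        simp only [hFn, abs_of_pos hx0]
        rw [if_neg (not_le.mpr hx.1)]
      have d1 := Real.hasDerivAt_arcsin (x := x) (by linarith) (by linarith [hx.2])
      have d2 : HasDerivAt (fun x : ℝ => 1 - x ^ 2) (-(2 * x)) x := by
        simpa using (hasDerivAt_pow 2 x).const_sub 1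
      have d3 := (hasDerivAt_id x).mul (d2.sqrt hpos.ne')
      have d4 := (d1.add d3).div_const 2
      convert! d4 using 1
      rw [hh]
      have hr := Real.sqrt_pos.mpr hpos
      have hr2 := Real.sq_sqrt hpos.le
      simp only [id]
      field_simp
      rw [hr2]; ring
    rw [intervalIntegral.integral_eq_sub_of_hasDerivAt_of_le hk1 _ hd (hI _ _)]
    · rw [hac, hsq]; simp; ring
    · exact Continuous.continuousOn (by have := Real.continuous_arcsin; fun_prop)
  rw [← intervalIntegral.integral_add_adjacent_intervals (hI (-1) 0) (hI 0 1), e1,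
    ← intervalIntegral.integral_add_adjacent_intervals (hI 0 k) (hI k 1), e2, e3]
  have : s ^ 2 = 1 - k ^ 2 := by linarith
  field_simp
  linear_combination (-2 * k) * this

lemma dualArea_Fa_eq {a : ℝ} {x : Pt} (hc : 0 < Real.cos x.2)
    (ht : thetaFn a x.2 ∈ Ioo 0 (π / 2)) :
    dualArea (Fa a) x = 2 * (thetaFn a x.2 +
      Real.cos (thetaFn a x.2) / Real.sin (thetaFn a x.2)) * Real.cos x.2 := by
  have hI := integral_hFn ht
  unfold dualArea Fa
  generalize thetaFn a x.2 = t at *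
  generalize Real.cos x.2 = c at *
  have hk : 0 < Real.cos t := Real.cos_pos_of_mem_Ioo ⟨by linarith [ht.1, Real.pi_pos], ht.2⟩
  have hs : 0 < Real.sin t := Real.sin_pos_of_pos_of_lt_pi ht.1 (by linarith [ht.2, Real.pi_pos])
  have h1 := Real.sin_sq_add_cos_sq t
  rw [← hI]
  clear hI
  generalize Real.cos t = k at *
  generalize Real.sin t = s at *
  set S : Set Pt := {y : Pt | ∀ v : Pt, max (Real.sqrt ((v.1 * c) ^ 2 + v.2 ^ 2))
    (|v.2| / s) ≤ 1 → y.1 * v.1 + y.2 * v.2 ≤ 1} with hS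
  have hmem : ∀ p q : ℝ, (p, q) ∈ S ↔
      ∀ x y : ℝ, x ^ 2 + y ^ 2 ≤ 1 → |y| ≤ s → (p / c) * x + q * y ≤ 1 := by
    intro p q
    rw [hS]
    have hsq1 : ∀ z : ℝ, Real.sqrt z ≤ 1 ↔ z ≤ 1 := fun z => by
      rw [Real.sqrt_le_left zero_le_one, one_pow]
    simp only [mem_ofPred_eq, max_le_iff, hsq1, div_le_one hs, Prod.forall]
    constructor
    · intro H x y h2 h3
      have := H (x / c) y ⟨by rwa [div_mul_cancel₀ _ hc.ne'], h3⟩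
      calc _ = p * (x / c) + q * y := by ring
        _ ≤ 1 := this
    · rintro H x y ⟨h2, h3⟩
      have := H (x * c) y h2 h3
      calc _ = p / c * (x * c) + q * y := by field_simp
        _ ≤ 1 := this
  have hcl : IsClosed S := by
    have : S = ⋂ v : Pt, ⋂ _ : max (Real.sqrt ((v.1 * c) ^ 2 + v.2 ^ 2))
        (|v.2| / s) ≤ 1, {y : Pt | y.1 * v.1 + y.2 * v.2 ≤ 1} := by
      ext y; simp [hS]
    rw [this]
    refine isClosed_iInter fun v => isClosed_iInter fun _ => ?_
    exact isClosed_le (by fun_prop) continuous_const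
  have hcont := hFn_cont hk hs h1
  have hvol : volume S = ENNReal.ofReal (∫ p in Ioo (-c) c, 2 * hFn k s (p / c)) := by
    rw [Measure.volume_eq_prod, Measure.prod_apply hcl.measurableSet]
    rw [ofReal_integral_eq_lintegral_ofReal]
    · rw [← lintegral_indicator measurableSet_Ioo]
      apply lintegral_congr_ae
      have hne : ∀ᵐ p : ℝ, p ≠ c ∧ p ≠ -c := by
        filter_upwards [Measure.ae_ne volume c, Measure.ae_ne volume (-c)] with p u v
        exact ⟨u, v⟩
      filter_upwards [hne] with p hp
      by_cases hpc : p ∈ Ioo (-c) c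
      · rw [indicator_of_mem hpc]
        have hlt : |p / c| < 1 := by
          rw [abs_div, abs_of_pos hc, div_lt_one hc]; exact abs_lt.mpr hpc
        have : Prod.mk p ⁻¹' S = Icc (-(hFn k s (p / c))) (hFn k s (p / c)) := by
          ext q
          rw [mem_preimage, hmem, dual_iff hk hs h1 hlt, abs_le, mem_Icc]
        rw [this, Real.volume_Icc]
        congr 1; ring
      · rw [indicator_of_notMem hpc]
        have : Prod.mk p ⁻¹' S = ∅ := by
          ext q
          simp only [mem_preimage, hmem, mem_empty_iff_false, iff_false]
          intro H
          apply hpc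
          have u1 := H 1 0 (by norm_num) (by simpa using hs.le)
          have u2 := H (-1) 0 (by norm_num) (by simpa using hs.le)
          have u3 : p / c ≤ 1 := by linarith
          have u4 : -1 ≤ p / c := by linarith
          rw [div_le_one hc] at u3
          rw [le_div_iff₀ hc] at u4
          exact ⟨lt_of_le_of_ne (by linarith) hp.2.symm, lt_of_le_of_ne u3 hp.1⟩
        rw [this, measure_empty]
    · have : Continuous fun p => 2 * hFn k s (p / c) := by fun_prop
      exact (this.integrableOn_Icc).mono_set Ioo_subset_Icc_self
    · exact Filter.Eventually.of_forall fun p =>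
        mul_nonneg zero_le_two (hFn_nonneg hk hs h1 _)
  rw [hvol, ENNReal.toReal_ofReal (integral_nonneg fun p =>
    mul_nonneg zero_le_two (hFn_nonneg hk hs h1 _)), ← integral_Ioc_eq_integral_Ioo,
    ← intervalIntegral.integral_of_le (by linarith), intervalIntegral.integral_const_mul,
    intervalIntegral.integral_comp_div _ hc.ne', neg_div, div_self hc.ne', smul_eq_mul]
  ring

lemma theta_facts {a v : ℝ} (ha : a ∈ Ioo 0 (π / 2)) (hv : v ∈ Ioo (-a) a) :
    0 < Real.cos a ∧ Real.cos a < Real.cos v := by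
  have h0 : 0 < Real.cos a := Real.cos_pos_of_mem_Ioo ⟨by linarith [ha.1, Real.pi_pos], ha.2⟩
  refine ⟨h0, ?_⟩
  rw [← Real.cos_abs v]
  exact Real.cos_lt_cos_of_nonneg_of_le_pi_div_two (abs_nonneg v) ha.2.le (abs_lt.mpr hv)

lemma main_integral {a : ℝ} (ha : a ∈ Ioo 0 (π / 2)) :
    ∫ v in (-a)..a, (Real.arccos (Real.cos a / Real.cos v) +
          Real.cos a / Real.sqrt (Real.cos v ^ 2 - Real.cos a ^ 2)) * Real.cos v = π := by
  have hle : -a ≤ a := by linarith [ha.1]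
  have hsa : 0 < Real.sin a := Real.sin_pos_of_pos_of_lt_pi ha.1 (by linarith [ha.2, Real.pi_pos])
  have hca : 0 < Real.cos a := Real.cos_pos_of_mem_Ioo ⟨by linarith [ha.1, Real.pi_pos], ha.2⟩
  have hcv : ∀ v ∈ Icc (-a) a, 0 < Real.cos v := fun v hv =>
    Real.cos_pos_of_mem_Ioo ⟨by linarith [ha.2, hv.1], by linarith [ha.2, hv.2]⟩
  set G : ℝ → ℝ := fun v => Real.arccos (Real.cos a / Real.cos v) * Real.sin v +
    Real.arcsin (Real.tan v / Real.tan a) with hG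
  have hta : 0 < Real.tan a := Real.tan_pos_of_pos_of_lt_pi_div_two ha.1 ha.2
  have hGc : ContinuousOn G (Icc (-a) a) := by
    intro v hv
    have h := (hcv v hv).ne'
    have t1 : ContinuousAt Real.tan v := Real.continuousAt_tan.mpr h
    have t2 : ContinuousAt (fun v => Real.cos a / Real.cos v) v :=
      continuousAt_const.div Real.continuous_cos.continuousAt h
    exact (((Real.continuous_arccos.continuousAt.comp t2).mul
      Real.continuous_sin.continuousAt).add
      (Real.continuous_arcsin.continuousAt.comp (t1.div_const _))).continuousWithinAt
  have hGd : ∀ v ∈ Ioo (-a) a, HasDerivAt G ((Real.arccos (Real.cos a / Real.cos v) +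
          Real.cos a / Real.sqrt (Real.cos v ^ 2 - Real.cos a ^ 2)) * Real.cos v) v := by
    intro v hv
    obtain ⟨-, hlt⟩ := theta_facts ha hv
    have hc := hcv v (Ioo_subset_Icc_self hv)
    have hpos : 0 < Real.cos v ^ 2 - Real.cos a ^ 2 := by nlinarith
    have hr := Real.sqrt_pos.mpr hpos
    have hr2 := Real.sq_sqrt hpos.le
    set r := Real.sqrt (Real.cos v ^ 2 - Real.cos a ^ 2) with hrdef
    have s1 : Real.sqrt (1 - (Real.cos a / Real.cos v) ^ 2) = r / Real.cos v := by
      rw [Real.sqrt_eq_iff_mul_self_eq_of_pos (by positivity)]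
      field_simp; linarith
    have p1 := Real.sin_sq_add_cos_sq v
    have p2 := Real.sin_sq_add_cos_sq a
    have s2 : Real.sqrt (1 - (Real.tan v / Real.tan a) ^ 2) =
        r / (Real.cos v * Real.sin a) := by
      rw [Real.sqrt_eq_iff_mul_self_eq_of_pos (by positivity), Real.tan_eq_sin_div_cos,
        Real.tan_eq_sin_div_cos]
      field_simp
      have q1 : Real.sin v ^ 2 = 1 - Real.cos v ^ 2 := by linarith
      have q2 : Real.sin a ^ 2 = 1 - Real.cos a ^ 2 := by linarith
      rw [hr2, q1, q2]; ring
    have x1 : Real.cos a / Real.cos v < 1 := (div_lt_one hc).mpr hlt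
    have x0 : 0 < Real.cos a / Real.cos v := by positivity
    have hpos2 : 0 < 1 - (Real.tan v / Real.tan a) ^ 2 := by
      apply Real.sqrt_pos.mp; rw [s2]; positivity
    have d1 := (Real.hasDerivAt_arccos (x := Real.cos a / Real.cos v) (by linarith)
      x1.ne).comp v ((hasDerivAt_const v (Real.cos a)).div (Real.hasDerivAt_cos v) hc.ne')
    have d2 := (Real.hasDerivAt_arcsin (x := Real.tan v / Real.tan a) (by
      intro h; rw [h] at hpos2; norm_num at hpos2) (by
      intro h; rw [h] at hpos2; norm_num at hpos2)).comp v
      ((Real.hasDerivAt_tan hc.ne').div_const (Real.tan a))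
    have d3 := (d1.mul (Real.hasDerivAt_sin v)).add d2
    convert! d3 using 1
    simp only [Function.comp, Pi.div_apply]
    rw [s1, s2, Real.tan_eq_sin_div_cos a]
    field_simp
    have q1 : Real.sin v ^ 2 = 1 - Real.cos v ^ 2 := by linarith
    ring_nf
    rw [q1]
    ring
  have hnn : ∀ v ∈ Ioo (-a) a, 0 ≤ (Real.arccos (Real.cos a / Real.cos v) +
          Real.cos a / Real.sqrt (Real.cos v ^ 2 - Real.cos a ^ 2)) * Real.cos v := by
    intro v hv
    have hc := hcv v (Ioo_subset_Icc_self hv)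
    have := Real.arccos_nonneg (Real.cos a / Real.cos v)
    positivity
  rw [intervalIntegral.integral_eq_sub_of_hasDerivAt_of_le hle hGc hGd]
  · simp only [hG, Real.cos_neg, Real.tan_neg, neg_div, div_self hta.ne', div_self hca.ne']
    simp
  · rw [intervalIntegrable_iff_integrableOn_Ioc_of_le hle]
    exact intervalIntegral.integrableOn_deriv_of_nonneg hGc hGd hnn

/-- Proposition 4.3 of the paper. For every `a ∈ (0, π/2)`, the
Holmes–Thompson volume of `M_{F_a}` equals `2π`; equivalently, the explicit integral of
the dual areas `(2θ(v) + 2/tan θ(v))·cos v` over the band equals `2π`. -/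
theorem spherical_finsler_mobius_band_volume (a : ℝ) (ha : a ∈ Ioo 0 (π / 2)) :
    mobiusVolHT π a (Fa a) = 2 * π ∧
    (2 / π) * ∫ _u in (-(π / 2))..(π / 2), ∫ v in (-a)..a,
        (Real.arccos (Real.cos a / Real.cos v) +
          Real.cos a / Real.sqrt (Real.cos v ^ 2 - Real.cos a ^ 2)) * Real.cos v
      = 2 * π := by
  have hle : -a ≤ a := by linarith [ha.1]
  have hm := main_integral ha
  constructor
  · unfold mobiusVolHT
    have e1 : (∫ x in Icc (0:ℝ) π ×ˢ Icc (-a) a, dualArea (Fa a) x) =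
        ∫ x in Icc (0:ℝ) π ×ˢ Icc (-a) a,
          (fun _ : ℝ => (1 : ℝ)) x.1 * (fun v : ℝ => dualArea (Fa a) (0, v)) x.2 := by
      congr 1
      ext x
      simp [dualArea, Fa]
    have e2 : (∫ v in Icc (-a) a, dualArea (Fa a) (0, v)) = 2 * π := by
      rw [integral_Icc_eq_integral_Ioo, ← hm, intervalIntegral.integral_of_le hle,
        integral_Ioc_eq_integral_Ioo, ← integral_const_mul]
      apply setIntegral_congr_fun measurableSet_Ioo
      intro v hv
      obtain ⟨h0, hlt⟩ := theta_facts ha hv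
      have hc : 0 < Real.cos v := h0.trans hlt
      have x1 : Real.cos a / Real.cos v < 1 := (div_lt_one hc).mpr hlt
      have x0 : 0 < Real.cos a / Real.cos v := by positivity
      have ht : thetaFn a v ∈ Ioo 0 (π / 2) :=
        ⟨Real.arccos_pos.mpr x1, Real.arccos_lt_pi_div_two.mpr x0⟩
      have hpos : 0 < Real.cos v ^ 2 - Real.cos a ^ 2 := by nlinarith
      have hr := Real.sqrt_pos.mpr hpos
      have hr2 := Real.sq_sqrt hpos.le
      have s1 : Real.sqrt (1 - (Real.cos a / Real.cos v) ^ 2) =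
          Real.sqrt (Real.cos v ^ 2 - Real.cos a ^ 2) / Real.cos v := by
        rw [Real.sqrt_eq_iff_mul_self_eq_of_pos (by positivity)]
        field_simp; linarith
      simp only
      rw [dualArea_Fa_eq (x := (0, v)) hc ht]
      simp only [thetaFn]
      rw [Real.sin_arccos, Real.cos_arccos (by linarith) x1.le, s1]
      field_simp
    rw [e1, Measure.volume_eq_prod, setIntegral_prod_mul (fun _ : ℝ => (1 : ℝ))
      (fun v : ℝ => dualArea (Fa a) (0, v)) (Icc (0:ℝ) π) (Icc (-a) a), e2]
    simp [Real.pi_pos.le]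
  · rw [hm, intervalIntegral.integral_const, smul_eq_mul]
    field_simp
    ring
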